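/- arXiv:2501.07929 — 2 statements merged into one kernel-verified Lean document; each statement's English description precedes it below -/
import Mathlib

section
/- Let d ≥ 1 be an integer, p > 1, and let K_{1,d} denote the star graph with one center joined to d leaves, with unit edge weights, unit vertex measures, and zero potentials. Then the largest eigenvalue of the signless p-Laplacian of K_{1,d} equals (1 + d^{1/(p−1)})^{p−1}. -/
open Finset

/-- `phiP p t = |t|^(p-2) * t` for `t ≠ 0`, and `0` for `t = 0`. -/
noncomputable def phiP (p t : ℝ) : ℝ := if t = 0 then 0 else |t| ^ (p - 2) * t

open Classical in
/-- The signless `p`-Laplacian of a finite simple graph (unit edge weights, unit vertex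
measures, zero potentials): `(Δ_p f)_i = ∑_{j ∼ i} Φ_p(f_i + f_j)`. -/
noncomputable def slap {V : Type*} [Fintype V] (G : SimpleGraph V) (p : ℝ) (f : V → ℝ) :
    V → ℝ :=
  fun i => ∑ j, if G.Adj i j then phiP p (f i + f j) else 0

/-- `(λ, f)` is an eigenpair of the signless `p`-Laplacian of `G`. -/
def SlapIsEigenpair {V : Type*} [Fintype V] (G : SimpleGraph V) (p lam : ℝ) (f : V → ℝ) :
    Prop :=
  f ≠ 0 ∧ ∀ i, slap G p f i = lam * phiP p (f i)

/-- The largest eigenvalue `λ_max^{(p)}(G)` of the signless `p`-Laplacian of `G`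
(the supremum of the set of eigenvalues, which is attained). -/
noncomputable def lamMax {V : Type*} [Fintype V] (G : SimpleGraph V) (p : ℝ) : ℝ :=
  sSup {lam : ℝ | ∃ f : V → ℝ, SlapIsEigenpair G p lam f}


lemma abs_phiP {p : ℝ} (hp : 1 < p) (t : ℝ) : |phiP p t| = |t| ^ (p - 1) := by
  unfold phiP
  split_ifs with h
  · subst h
    rw [abs_zero, Real.zero_rpow (by linarith)]
  · have ht : 0 < |t| := abs_pos.mpr h
    rw [abs_mul, abs_of_nonneg (Real.rpow_nonneg ht.le _)]
    have : p - 1 = (p - 2) + 1 := by ring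
    rw [this, Real.rpow_add ht, Real.rpow_one]

lemma phiP_pos {p : ℝ} (hp : 1 < p) {t : ℝ} (ht : 0 < t) : phiP p t = t ^ (p - 1) := by
  rw [← abs_of_pos ht, ← abs_phiP hp, abs_of_pos ht, abs_of_nonneg]
  unfold phiP
  split_ifs
  · exact le_rfl
  · positivity

lemma slap_center (d : ℕ) (p : ℝ) (f : Fin 1 ⊕ Fin d → ℝ) :
    slap (completeBipartiteGraph (Fin 1) (Fin d)) p f (Sum.inl 0) =
      ∑ j, phiP p (f (Sum.inl 0) + f (Sum.inr j)) := by
  simp [slap]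

lemma slap_leaf (d : ℕ) (p : ℝ) (f : Fin 1 ⊕ Fin d → ℝ) (j : Fin d) :
    slap (completeBipartiteGraph (Fin 1) (Fin d)) p f (Sum.inr j) =
      phiP p (f (Sum.inr j) + f (Sum.inl 0)) := by
  simp [slap]

/-- the largest eigenvalue of the signless `p`-Laplacian of the star
`K_{1,d}` equals `(1 + d^{1/(p-1)})^{p-1}`. -/
theorem lamMax_star
    (d : ℕ) (hd : 1 ≤ d) (p : ℝ) (hp : 1 < p) :
    lamMax (completeBipartiteGraph (Fin 1) (Fin d)) p =
      (1 + (d : ℝ) ^ (1 / (p - 1))) ^ (p - 1) := by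
  have hq : 0 < p - 1 := by linarith
  have hd0 : (0 : ℝ) < d := by exact_mod_cast hd
  set c : ℝ := (d : ℝ) ^ (1 / (p - 1)) with hc
  have hc0 : 0 < c := Real.rpow_pos_of_pos hd0 _
  have hcq : c ^ (p - 1) = d := by
    rw [hc, ← Real.rpow_mul hd0.le, one_div, inv_mul_cancel₀ hq.ne', Real.rpow_one]
  have hL0 : 0 < (1 + c) ^ (p - 1) := by positivity
  unfold lamMax
  apply IsGreatest.csSup_eq
  constructor
  · refine ⟨Sum.elim (fun _ => c) (fun _ => 1), ?_, ?_⟩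
    · intro h
      have := congrFun h (Sum.inl 0)
      simp at this
      exact hc0.ne' this
    · rintro (i | j)
      · obtain rfl : i = 0 := Subsingleton.elim _ _
        rw [slap_center]
        simp only [Sum.elim_inl, Sum.elim_inr]
        rw [phiP_pos hp hc0, phiP_pos hp (by positivity), hcq, add_comm c 1]
        simp [mul_comm]
      · rw [slap_leaf]
        simp only [Sum.elim_inl, Sum.elim_inr]
        rw [phiP_pos hp one_pos, phiP_pos hp (by positivity)]
        simp
  · rintro lam ⟨f, hf, he⟩
    by_contra! hlt
    have hlam : 0 < lam := hL0.trans hlt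
    have hleaf : ∀ j, c * |f (Sum.inr j)| ≤ |f (Sum.inl 0)| := by
      intro j
      by_contra! h
      have h1 := congrArg abs (he (Sum.inr j))
      rw [slap_leaf, abs_mul, abs_phiP hp, abs_phiP hp, abs_of_pos hlam] at h1
      have h2 : |f (Sum.inr j) + f (Sum.inl 0)| < (1 + c) * |f (Sum.inr j)| := by
        have := abs_add_le (f (Sum.inr j)) (f (Sum.inl 0))
        linarith
      have h3 := Real.rpow_lt_rpow (abs_nonneg _) h2 hq
      rw [Real.mul_rpow (by positivity) (abs_nonneg _), h1] at h3
      have h4 : 0 ≤ |f (Sum.inr j)| ^ (p - 1) := by positivity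
      nlinarith
    have hx : f (Sum.inl 0) ≠ 0 := by
      intro hx
      apply hf
      funext i
      rcases i with i | j
      · obtain rfl : i = 0 := Subsingleton.elim _ _
        simpa using hx
      · have := hleaf j
        rw [hx, abs_zero] at this
        have h0 : |f (Sum.inr j)| ≤ 0 := by
          by_contra! h
          nlinarith [mul_pos hc0 h]
        simpa using abs_nonpos_iff.mp h0
    have hx0 : 0 < |f (Sum.inl 0)| ^ (p - 1) := Real.rpow_pos_of_pos (abs_pos.mpr hx) _
    have h1 := congrArg abs (he (Sum.inl 0))
    rw [slap_center, abs_mul, abs_phiP hp, abs_of_pos hlam] at h1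
    have h2 : |∑ j, phiP p (f (Sum.inl 0) + f (Sum.inr j))| ≤
        ∑ _j : Fin d, ((1 + c) ^ (p - 1) * |f (Sum.inl 0)| ^ (p - 1) / d) := by
      refine (Finset.abs_sum_le_sum_abs _ _).trans (Finset.sum_le_sum fun j _ => ?_)
      rw [abs_phiP hp, ← hcq, ← Real.mul_rpow (by positivity) (abs_nonneg _),
        ← Real.div_rpow (by positivity) hc0.le]
      apply Real.rpow_le_rpow (abs_nonneg _) _ hq.le
      rw [le_div_iff₀ hc0]
      have := abs_add_le (f (Sum.inl 0)) (f (Sum.inr j))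
      nlinarith [hleaf j]
    rw [h1, Finset.sum_const, Finset.card_univ, Fintype.card_fin, nsmul_eq_mul,
      mul_div_cancel₀ _ hd0.ne'] at h2
    nlinarith
end

section
/- Let G=(V,E) be a finite simple undirected graph with unit edge weights, unit vertex measures, and zero potentials, and let d ≥ 1 be an integer. Then λ_max^(p)(K_{1,d}) ≤ λ_max^(p)(G) holds for every p > 1 if and only if K_{1,d} is a subgraph of G (equivalently, G has a vertex of degree at least d). -/
open Finset

lemma phiP_eq (p t : ℝ) : phiP p t = |t| ^ (p - 2) * t := by
  unfold phiP; split_ifs with h <;> simp [h]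

lemma phiP_mul_self {p : ℝ} (hp : 1 < p) (t : ℝ) : phiP p t * t = |t| ^ p := by
  rw [phiP_eq]
  by_cases h : t = 0
  · subst h; simp [Real.zero_rpow (by linarith : p ≠ 0)]
  · have h0 : 0 < |t| := abs_pos.mpr h
    rw [mul_assoc, ← abs_mul_abs_self t, ← mul_assoc, ← Real.rpow_add_one h0.ne',
      ← Real.rpow_add_one h0.ne']
    congr 1; ring

open Classical in
/-- Twice the edge energy. -/
noncomputable def numP {V : Type*} [Fintype V] (G : SimpleGraph V) (p : ℝ) (f : V → ℝ) : ℝ :=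
  ∑ i, ∑ j, if G.Adj i j then |f i + f j| ^ p else 0

/-- The p-th power of the p-norm. -/
noncomputable def denP {V : Type*} [Fintype V] (p : ℝ) (f : V → ℝ) : ℝ :=
  ∑ i, |f i| ^ p

open Classical in
lemma slap_pair {V : Type*} [Fintype V] (G : SimpleGraph V) (p : ℝ) (f h : V → ℝ) :
    ∑ i, ∑ j, (if G.Adj i j then phiP p (f i + f j) * (h i + h j) else 0)
      = 2 * ∑ i, slap G p f i * h i := by
  have e1 : ∑ i, slap G p f i * h i
      = ∑ i, ∑ j, (if G.Adj i j then phiP p (f i + f j) * h i else 0) := by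
    refine Finset.sum_congr rfl fun i _ => ?_
    simp only [slap, Finset.sum_mul, ite_mul, zero_mul]
  have e2 : ∑ i, slap G p f i * h i
      = ∑ i, ∑ j, (if G.Adj i j then phiP p (f i + f j) * h j else 0) := by
    rw [e1, Finset.sum_comm]
    refine Finset.sum_congr rfl fun i _ => Finset.sum_congr rfl fun j _ => ?_
    simp only [G.adj_comm j i, add_comm (f j) (f i)]
  rw [two_mul]
  nth_rewrite 1 [e1]
  rw [e2, ← Finset.sum_add_distrib]
  refine Finset.sum_congr rfl fun i _ => ?_
  rw [← Finset.sum_add_distrib]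
  refine Finset.sum_congr rfl fun j _ => ?_
  split_ifs <;> ring

lemma eig_num {V : Type*} [Fintype V] {G : SimpleGraph V} {p lam : ℝ} (hp : 1 < p) {f : V → ℝ}
    (h : SlapIsEigenpair G p lam f) : numP G p f = 2 * (lam * denP p f) := by
  classical
  have := slap_pair G p f f
  simp only [phiP_mul_self hp, h.2, mul_assoc] at this
  rw [← Finset.mul_sum] at this
  unfold numP denP
  convert this

lemma denP_pos {V : Type*} [Fintype V] {p : ℝ} {f : V → ℝ} (h : f ≠ 0) : 0 < denP p f := by
  obtain ⟨i, hi⟩ := Function.ne_iff.mp h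
  refine Finset.sum_pos' (fun i _ => by positivity) ⟨i, Finset.mem_univ _, ?_⟩
  exact Real.rpow_pos_of_pos (abs_pos.mpr hi) _

lemma denP_smul {V : Type*} [Fintype V] (p : ℝ) (c : ℝ) (f : V → ℝ) :
    denP p (c • f) = |c| ^ p * denP p f := by
  simp only [denP, Pi.smul_apply, smul_eq_mul, abs_mul, Finset.mul_sum,
    Real.mul_rpow (abs_nonneg _) (abs_nonneg _)]

lemma numP_smul {V : Type*} [Fintype V] (G : SimpleGraph V) (p : ℝ) (c : ℝ) (f : V → ℝ) :
    numP G p (c • f) = |c| ^ p * numP G p f := by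
  simp only [numP, Pi.smul_apply, smul_eq_mul, ← mul_add, abs_mul, Finset.mul_sum,
    Real.mul_rpow (abs_nonneg _) (abs_nonneg _), mul_ite, mul_zero]

lemma abs_add_rpow_le {p : ℝ} (hp : 1 < p) (a b : ℝ) :
    |a + b| ^ p ≤ 2 ^ (p - 1) * (|a| ^ p + |b| ^ p) := by
  refine (Real.rpow_le_rpow (abs_nonneg _) (abs_add_le a b) (by linarith)).trans ?_
  have := NNReal.rpow_add_le_mul_rpow_add_rpow ⟨|a|, abs_nonneg a⟩ ⟨|b|, abs_nonneg b⟩ hp.le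
  exact_mod_cast this

lemma numP_le {V : Type*} [Fintype V] (G : SimpleGraph V) [DecidableRel G.Adj] {p : ℝ}
    (hp : 1 < p) (D : ℕ) (hD : ∀ v, G.degree v ≤ D) (f : V → ℝ) :
    numP G p f ≤ 2 * (2 ^ (p - 1) * D * denP p f) := by
  classical
  have hA : ∑ i, ∑ j, (if G.Adj i j then |f i| ^ p else 0) ≤ D * denP p f := by
    rw [denP, Finset.mul_sum]
    refine Finset.sum_le_sum fun i _ => ?_
    rw [← Finset.sum_filter, Finset.sum_const, nsmul_eq_mul]
    refine mul_le_mul_of_nonneg_right ?_ (by positivity)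
    have := hD i
    rw [← G.card_neighborFinset_eq_degree, G.neighborFinset_eq_filter] at this
    exact_mod_cast this
  have hB : ∑ i, ∑ j, (if G.Adj i j then |f j| ^ p else 0) ≤ D * denP p f := by
    rw [Finset.sum_comm]
    simpa only [G.adj_comm] using hA
  have : numP G p f ≤ 2 ^ (p - 1) * (∑ i, ∑ j, (if G.Adj i j then |f i| ^ p else 0)
      + ∑ i, ∑ j, (if G.Adj i j then |f j| ^ p else 0)) := by
    rw [← Finset.sum_add_distrib, Finset.mul_sum]
    refine Finset.sum_le_sum fun i _ => ?_
    rw [← Finset.sum_add_distrib, Finset.mul_sum]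
    refine Finset.sum_le_sum fun j _ => ?_
    split_ifs
    · exact abs_add_rpow_le hp _ _
    · simp
  have h2 : (0:ℝ) < 2 ^ (p - 1) := by positivity
  nlinarith [mul_le_mul_of_nonneg_left (add_le_add hA hB) h2.le]

lemma eig_le {V : Type*} [Fintype V] {G : SimpleGraph V} {p lam M : ℝ} (hp : 1 < p) {f : V → ℝ}
    (h : SlapIsEigenpair G p lam f) (hM : numP G p f ≤ 2 * (M * denP p f)) : lam ≤ M := by
  have h1 := eig_num hp h
  have h2 := denP_pos (p := p) h.1
  by_contra! hc
  nlinarith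

lemma eig_bdd {V : Type*} [Fintype V] (G : SimpleGraph V) {p : ℝ} (hp : 1 < p) :
    BddAbove {lam : ℝ | ∃ f : V → ℝ, SlapIsEigenpair G p lam f} := by
  classical
  refine ⟨2 ^ (p - 1) * (Fintype.card V : ℕ), ?_⟩
  rintro lam ⟨f, h⟩
  exact eig_le hp h (numP_le G hp _ (fun v => (G.degree_lt_card_verts v).le) f)

lemma hasDeriv_num {V : Type*} [Fintype V] (G : SimpleGraph V) {p : ℝ} (hp : 1 < p)
    (f h : V → ℝ) :
    HasDerivAt (fun t : ℝ => numP G p (f + t • h)) (p * (2 * ∑ i, slap G p f i * h i)) 0 := by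
  classical
  rw [← slap_pair, Finset.mul_sum]
  unfold numP
  refine HasDerivAt.fun_sum fun i _ => ?_
  rw [Finset.mul_sum]
  refine HasDerivAt.fun_sum fun j _ => ?_
  split_ifs
  · have h1 : HasDerivAt (fun t : ℝ => (f + t • h) i + (f + t • h) j) (h i + h j) 0 := by
      have := ((hasDerivAt_id (0:ℝ)).mul_const (h i + h j)).const_add (f i + f j)
      have e : (fun t : ℝ => (f + t • h) i + (f + t • h) j)
          = fun t : ℝ => f i + f j + id t * (h i + h j) := by
        funext t; simp; ring
      rw [e]
      exact this.congr_deriv (by simp)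
    have h2 := (hasDerivAt_abs_rpow ((f + (0:ℝ) • h) i + (f + (0:ℝ) • h) j) hp).comp 0 h1
    refine h2.congr_deriv ?_
    simp [phiP_eq]; ring
  · simpa using hasDerivAt_const (0:ℝ) (0:ℝ)

lemma hasDeriv_den {V : Type*} [Fintype V] {p : ℝ} (hp : 1 < p) (f h : V → ℝ) :
    HasDerivAt (fun t : ℝ => denP p (f + t • h)) (p * ∑ i, phiP p (f i) * h i) 0 := by
  rw [Finset.mul_sum]
  unfold denP
  refine HasDerivAt.fun_sum fun i _ => ?_
  have h1 : HasDerivAt (fun t : ℝ => (f + t • h) i) (h i) 0 := by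
    have := ((hasDerivAt_id (0:ℝ)).mul_const (h i)).const_add (f i)
    exact this.congr_deriv (by simp)
  have h2 := (hasDerivAt_abs_rpow ((f + (0:ℝ) • h) i) hp).comp 0 h1
  refine h2.congr_deriv ?_
  simp [phiP_eq]; ring

lemma exists_max {V : Type*} [Fintype V] [Nonempty V] (G : SimpleGraph V) {p : ℝ} (hp : 1 < p) :
    ∃ (lam : ℝ) (f : V → ℝ), SlapIsEigenpair G p lam f ∧
      ∀ g, numP G p g ≤ 2 * (lam * denP p g) := by
  classical
  have hp0 : 0 < p := by linarith
  have cD : Continuous (fun f : V → ℝ => denP p f) := by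
    unfold denP
    refine continuous_finsetSum _ fun i _ => ?_
    exact ((continuous_apply i).abs).rpow_const fun _ => Or.inr hp0.le
  have cN : Continuous (fun f : V → ℝ => numP G p f) := by
    unfold numP
    refine continuous_finsetSum _ fun i _ => continuous_finsetSum _ fun j _ => ?_
    split_ifs
    · exact (((continuous_apply i).add (continuous_apply j)).abs).rpow_const
        fun _ => Or.inr hp0.le
    · exact continuous_const
  have hd0 : denP p (0 : V → ℝ) = 0 := by simp [denP, Real.zero_rpow hp0.ne']
  have hn0 : numP G p (0 : V → ℝ) = 0 := by simp [numP, Real.zero_rpow hp0.ne']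
  have comp : IsCompact {f : V → ℝ | denP p f = 1} := by
    refine Metric.isCompact_of_isClosed_isBounded (isClosed_eq cD continuous_const) ?_
    refine (Metric.isBounded_iff_subset_closedBall 0).mpr ⟨1, fun f hf => ?_⟩
    rw [mem_closedBall_zero_iff, pi_norm_le_iff_of_nonneg zero_le_one]
    intro i
    have h1 : |f i| ^ p ≤ 1 := by
      rw [← (show denP p f = 1 from hf)]
      exact Finset.single_le_sum (f := fun i => |f i| ^ p) (fun i _ => by positivity)
        (Finset.mem_univ i)
    rw [Real.norm_eq_abs]
    by_contra! hc
    exact absurd h1 (not_le.mpr (Real.one_lt_rpow hc hp0))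
  have scale : ∀ g : V → ℝ, g ≠ 0 → ∃ c : ℝ, 0 < |c| ^ p ∧ denP p (c • g) = 1 := by
    intro g hg
    have hpos := denP_pos (p := p) hg
    have : |(denP p g) ^ (-(1 / p))| ^ p = (denP p g)⁻¹ := by
      rw [abs_of_nonneg (by positivity), ← Real.rpow_mul hpos.le]
      rw [show -(1 / p) * p = -1 by field_simp, Real.rpow_neg_one]
    refine ⟨(denP p g) ^ (-(1 / p)), ?_, ?_⟩
    · rw [this]; positivity
    · rw [denP_smul, this]; field_simp
  obtain ⟨c, _, hc⟩ := scale (fun _ => 1) (by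
    intro h
    have := congrFun h (Classical.arbitrary V)
    simp at this)
  obtain ⟨f, hf1, hfmax⟩ := comp.exists_isMaxOn ⟨_, hc⟩ cN.continuousOn
  have hf1 : denP p f = 1 := hf1
  have key : ∀ g, numP G p g ≤ 2 * (numP G p f / 2 * denP p g) := by
    intro g
    by_cases hg : g = 0
    · rw [hg, hd0, hn0]; simp
    · obtain ⟨c, hc, h1⟩ := scale g hg
      have h2 : numP G p (c • g) ≤ numP G p f := hfmax h1
      rw [numP_smul] at h2
      rw [denP_smul] at h1
      have h3 : |c| ^ p * numP G p g ≤ |c| ^ p * (numP G p f * denP p g) := by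
        calc _ ≤ numP G p f := h2
          _ = numP G p f * (|c| ^ p * denP p g) := by rw [h1, mul_one]
          _ = _ := by ring
      have := le_of_mul_le_mul_left h3 hc
      linarith
  refine ⟨numP G p f / 2, f, ⟨?_, ?_⟩, key⟩
  · rintro rfl
    rw [hd0] at hf1; norm_num at hf1
  · intro i
    have hder := (hasDeriv_num G hp f (Pi.single i 1)).sub
      ((hasDeriv_den hp f (Pi.single i 1)).const_mul (numP G p f))
    have hz := IsLocalMax.hasDerivAt_eq_zero (a := (0:ℝ)) (Filter.Eventually.of_forall (by
      intro t
      have := key (f + t • Pi.single i (1:ℝ))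
      simp only [Pi.sub_apply, zero_smul, add_zero, hf1]
      linarith)) hder
    simp only [Pi.single_apply, mul_ite, mul_one, mul_zero, Finset.sum_ite_eq',
      Finset.mem_univ, if_true] at hz
    have : p * (2 * slap G p f i - numP G p f * phiP p (f i)) = 0 := by linarith
    have := (mul_eq_zero.mp this).resolve_left hp0.ne'
    linarith

lemma numP_extend {W V : Type*} [Fintype W] [Fintype V] (H : SimpleGraph W) (G : SimpleGraph V)
    (p : ℝ) (e : W → V) (he : Function.Injective e) (hom : ∀ a b, H.Adj a b → G.Adj (e a) (e b))
    (f : W → ℝ) : numP H p f ≤ numP G p (Function.extend e f 0) := by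
  classical
  unfold numP
  simp only [← Fintype.sum_prod_type']
  set F : V × V → ℝ := fun x => if G.Adj x.1 x.2 then
    |Function.extend e f 0 x.1 + Function.extend e f 0 x.2| ^ p else 0 with hF
  have hFn : ∀ x, 0 ≤ F x := by intro x; simp only [hF]; split_ifs <;> positivity
  calc _ ≤ ∑ x : W × W, F (Prod.map e e x) := by
        refine Finset.sum_le_sum fun x _ => ?_
        simp only [hF, Prod.map_fst, Prod.map_snd, he.extend_apply]
        split_ifs with h1 h2
        · exact le_rfl
        · exact absurd (hom _ _ h1) h2
        · positivity
        · exact le_rfl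
    _ = ∑ x ∈ Finset.univ.image (Prod.map e e), F x := by
        rw [Finset.sum_image ((he.prodMap he).injOn)]
    _ ≤ ∑ x, F x := Finset.sum_le_sum_of_subset_of_nonneg (Finset.subset_univ _)
        fun x _ _ => hFn x

lemma denP_extend {W V : Type*} [Fintype W] [Fintype V] {p : ℝ} (hp : 1 < p) (e : W → V)
    (he : Function.Injective e) (f : W → ℝ) :
    denP p (Function.extend e f 0) = denP p f := by
  classical
  unfold denP
  symm
  calc _ = ∑ x ∈ Finset.univ.image e, |Function.extend e f 0 x| ^ p := by
        rw [Finset.sum_image he.injOn]; simp only [he.extend_apply]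
    _ = _ := by
        refine Finset.sum_subset (Finset.subset_univ _) fun x _ hx => ?_
        rw [Function.extend_apply']
        · simp [Real.zero_rpow (by linarith : p ≠ 0)]
        · rintro ⟨a, rfl⟩; exact hx (by simp)

lemma star_eig (d : ℕ) (hd : 1 ≤ d) {p : ℝ} (hp : 1 < p) :
    ∃ lam : ℝ, (d : ℝ) ≤ lam ∧ ∃ f, SlapIsEigenpair (completeBipartiteGraph (Fin 1) (Fin d)) p lam f := by
  have hd' : (0:ℝ) < d := by exact_mod_cast hd
  have hp1 : 0 < p - 1 := by linarith
  have phipos : ∀ t : ℝ, 0 < t → phiP p t = t ^ (p - 1) := by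
    intro t ht
    rw [phiP_eq, abs_of_pos ht, ← Real.rpow_add_one ht.ne']; congr 1; ring
  set a : ℝ := (d : ℝ) ^ (1 / (p - 1)) with ha
  have ha0 : 0 < a := by positivity
  have had : a ^ (p - 1) = d := by
    rw [ha, ← Real.rpow_mul hd'.le, one_div_mul_cancel hp1.ne', Real.rpow_one]
  refine ⟨(a + 1) ^ (p - 1), ?_, Sum.elim (fun _ => a) (fun _ => 1), ?_, ?_⟩
  · rw [← had]
    exact Real.rpow_le_rpow ha0.le (by linarith) hp1.le
  · intro h
    have := congrFun h (Sum.inl 0)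
    simp at this
    linarith
  · rintro (i | i)
    · simp [slap, phipos _ ha0, phipos (a + 1) (by linarith), had]; ring
    · simp [slap, phipos 1 one_pos, phipos (1 + a) (by linarith), add_comm]

/-- `λ_max^{(p)}(K_{1,d}) ≤ λ_max^{(p)}(G)` for every `p > 1` if and only if
`K_{1,d}` is a subgraph of `G`, i.e. `G` has a vertex of degree at least `d`. -/
theorem lamMax_star_le_iff_subgraph
    {V : Type*} [Fintype V] (G : SimpleGraph V) [DecidableRel G.Adj]
    (d : ℕ) (hd : 1 ≤ d) :
    (∀ p : ℝ, 1 < p →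
        lamMax (completeBipartiteGraph (Fin 1) (Fin d)) p ≤ lamMax G p) ↔
      ∃ v : V, d ≤ G.degree v := by
  constructor
  · intro h
    by_contra! hc
    have hlim : Filter.Tendsto (fun p : ℝ => (2:ℝ) ^ (p - 1) * ((d - 1 : ℕ) : ℝ))
        (nhdsWithin 1 (Set.Ioi 1)) (nhds ((2:ℝ) ^ ((1:ℝ) - 1) * ((d - 1 : ℕ) : ℝ))) := by
      refine Filter.Tendsto.mono_left ?_ nhdsWithin_le_nhds
      have : Continuous (fun p : ℝ => (2:ℝ) ^ (p - 1) * ((d - 1 : ℕ) : ℝ)) :=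
        (continuous_const.rpow (continuous_id.sub continuous_const)
          (fun _ => Or.inl two_ne_zero)).mul continuous_const
      exact this.tendsto 1
    have hlt : (2:ℝ) ^ ((1:ℝ) - 1) * ((d - 1 : ℕ) : ℝ) < d := by
      rw [sub_self, Real.rpow_zero, one_mul]
      exact_mod_cast Nat.sub_lt hd one_pos
    obtain ⟨p, hpd, hp⟩ := ((hlim.eventually_lt_const hlt).and self_mem_nhdsWithin).exists
    have hp : 1 < p := hp
    obtain ⟨lam, hlam, hf⟩ := star_eig d hd hp
    have h1 : lam ≤ lamMax (completeBipartiteGraph (Fin 1) (Fin d)) p :=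
      le_csSup (eig_bdd _ hp) hf
    have h2 : lamMax G p ≤ (2:ℝ) ^ (p - 1) * ((d - 1 : ℕ) : ℝ) := by
      refine Real.sSup_le ?_ (by positivity)
      rintro l ⟨f, hl⟩
      exact eig_le hp hl (numP_le G hp _ (fun v => Nat.le_sub_one_of_lt (hc v)) f)
    have := h p hp
    linarith
  · rintro ⟨v, hv⟩ p hp
    classical
    haveI : Nonempty V := ⟨v⟩
    obtain ⟨M, f0, hM, hmax⟩ := exists_max G hp
    have hML : M ≤ lamMax G p := le_csSup (eig_bdd _ hp) ⟨f0, hM⟩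
    obtain ⟨_, _, hne⟩ := star_eig d hd hp
    refine le_trans (csSup_le ⟨_, hne⟩ ?_) hML
    rintro l ⟨f, hl⟩
    have hcard : Fintype.card (Fin d) ≤ Fintype.card (G.neighborSet v) := by
      rw [Fintype.card_fin, G.card_neighborSet_eq_degree]; exact hv
    obtain ⟨ε⟩ := Function.Embedding.nonempty_of_card_le hcard
    let e : Fin 1 ⊕ Fin d → V := Sum.elim (fun _ => v) (fun i => (ε i : V))
    have hadj : ∀ i, G.Adj v (ε i) := fun i => (ε i).2
    have he : Function.Injective e := by
      rintro (i | i) (j | j) hij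
      · rw [Subsingleton.elim i j]
      · exact absurd hij (hadj j).ne
      · exact absurd hij (hadj i).ne'
      · rw [ε.injective (Subtype.ext hij)]
    have hom : ∀ a b, (completeBipartiteGraph (Fin 1) (Fin d)).Adj a b → G.Adj (e a) (e b) := by
      rintro (i | i) (j | j) hij
      · simp at hij
      · exact hadj j
      · exact (hadj i).symm
      · simp at hij
    refine eig_le hp hl ?_
    calc _ ≤ _ := numP_extend _ G p e he hom f
      _ ≤ _ := hmax _
      _ = _ := by rw [denP_extend hp e he]
end
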